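/- arXiv:1607.08484 — 7 statements merged into one kernel-verified Lean document; each statement's English description precedes it below -/
import Mathlib

section
/- Let A₁, A₂, A₃ be finite-state finite-transition action agnostic probabilistic automata. If A₁ ∼paa A₂ (A₁ and A₂ are probabilistically bisimilar), then their synchronous products satisfy A₁ ⊗ A₃ ∼paa A₂ ⊗ A₃. -/
open scoped Classical

noncomputable section

/-- A function `δ : S → ℝ` is a discrete probability distribution on the finite set `S`. -/
def IsDist {S : Type*} [Fintype S] (δ : S → ℝ) : Prop :=
  (∀ s, 0 ≤ δ s) ∧ ∑ s, δ s = 1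

/-- The probability assigned by `δ` to the `R`-equivalence class of `x`. -/
def classSum {S : Type*} [Fintype S] (R : S → S → Prop) (δ : S → ℝ) (x : S) : ℝ :=
  ∑ y, if R x y then δ y else 0

/-- Lifting `L(R)` of a relation `R` to distributions: `δ₁ L(R) δ₂` iff `δ₁(C) = δ₂(C)`
for every equivalence class `C` of `R`. -/
def Lift {S : Type*} [Fintype S] (R : S → S → Prop) (δ₁ δ₂ : S → ℝ) : Prop :=
  ∀ x, classSum R δ₁ x = classSum R δ₂ x

/-- An action agnostic probabilistic automaton. -/
structure PA (S : Type*) (AP : Type*) where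
  start : S
  label : S → Set AP
  trans : Set (S × (S → ℝ))

/-- Well-formedness of a PA: the transition relation is finite and all targets are
discrete probability distributions. -/
def PA.WF {S AP : Type*} [Fintype S] (A : PA S AP) : Prop :=
  A.trans.Finite ∧ ∀ p ∈ A.trans, IsDist p.2

/-- Combined transition `s ⟶_C δ`: `δ` is a finite convex combination of targets of
transitions enabled at `s`. -/
def PA.ctrans {S AP : Type*} (A : PA S AP) (s : S) (δ : S → ℝ) : Prop :=
  ∃ (n : ℕ) (p : Fin n → ℝ) (η : Fin n → S → ℝ),
    (∀ i, 0 ≤ p i) ∧ (∀ i, (s, η i) ∈ A.trans) ∧ ∑ i, p i = 1 ∧ δ = ∑ i, p i • η i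

/-- Probabilistic bisimulation on a PA. -/
def PA.IsBisim {S AP : Type*} [Fintype S] (A : PA S AP) (R : S → S → Prop) : Prop :=
  Equivalence R ∧ ∀ s t, R s t → A.label s = A.label t ∧
    ∀ δ, (s, δ) ∈ A.trans → ∃ η, A.ctrans t η ∧ Lift R δ η

/-- Two states of a PA are probabilistically bisimilar. -/
def PA.bisimStates {S AP : Type*} [Fintype S] (A : PA S AP) (s t : S) : Prop :=
  ∃ R, A.IsBisim R ∧ R s t

/-- Disjoint union of two PAs. -/
def PA.disjUnion {S₁ S₂ AP : Type*} (A₁ : PA S₁ AP) (A₂ : PA S₂ AP) : PA (S₁ ⊕ S₂) AP where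
  start := Sum.inl A₁.start
  label := Sum.elim A₁.label A₂.label
  trans :=
    (fun q : S₁ × (S₁ → ℝ) => ((Sum.inl q.1 : S₁ ⊕ S₂), Sum.elim q.2 fun _ => (0 : ℝ))) '' A₁.trans ∪
    (fun q : S₂ × (S₂ → ℝ) => ((Sum.inr q.1 : S₁ ⊕ S₂), Sum.elim (fun _ => (0 : ℝ)) q.2)) '' A₂.trans

/-- Two PAs are probabilistically bisimilar (`∼paa`): some probabilistic bisimulation on
their disjoint union relates their start states. -/
def PA.Bisimilar {S₁ S₂ AP : Type*} [Fintype S₁] [Fintype S₂]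
    (A₁ : PA S₁ AP) (A₂ : PA S₂ AP) : Prop :=
  ∃ R, (A₁.disjUnion A₂).IsBisim R ∧ R (Sum.inl A₁.start) (Sum.inr A₂.start)

/-- Product of two distributions. -/
def distProd {S₁ S₂ : Type*} (δ₁ : S₁ → ℝ) (δ₂ : S₂ → ℝ) : S₁ × S₂ → ℝ :=
  fun p => δ₁ p.1 * δ₂ p.2

/-- Synchronous product of PAs. -/
def PA.syncProd {S₁ S₂ AP : Type*} (A₁ : PA S₁ AP) (A₂ : PA S₂ AP) : PA (S₁ × S₂) AP where
  start := (A₁.start, A₂.start)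
  label := fun p => A₁.label p.1 ∪ A₂.label p.2
  trans := {p | ∃ q₁ ∈ A₁.trans, ∃ q₂ ∈ A₂.trans, p = ((q₁.1, q₂.1), distProd q₁.2 q₂.2)}

/-- An interval Markov decision process: intervals are given by their lower and upper
bound functions. -/
structure IMDP (S : Type*) (Act : Type*) (AP : Type*) where
  start : S
  label : S → Set AP
  low : S → Act → S → ℝ
  high : S → Act → S → ℝ

/-- The set of enabled actions of a state: those `a` with `I(s,a,s') ≠ [0,0]` for some `s'`. -/
def IMDP.enabled {S Act AP : Type*} (M : IMDP S Act AP) (s : S) : Set Act :=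
  {a | ∃ s', ¬ (M.low s a s' = 0 ∧ M.high s a s' = 0)}

/-- The uncertainty set `ℋ^a_s` of feasible successor distributions. -/
def IMDP.unc {S Act AP : Type*} [Fintype S] (M : IMDP S Act AP) (s : S) (a : Act) :
    Set (S → ℝ) :=
  {δ | IsDist δ ∧ ∀ s', δ s' ∈ Set.Icc (M.low s a s') (M.high s a s')}

/-- Well-formedness of an IMDP: intervals are closed subintervals of `[0,1]`, each state
has an enabled action, and each uncertainty set of an enabled action is nonempty. -/
def IMDP.WF {S Act AP : Type*} [Fintype S] (M : IMDP S Act AP) : Prop :=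
  (∀ s a s', 0 ≤ M.low s a s' ∧ M.low s a s' ≤ M.high s a s' ∧ M.high s a s' ≤ 1) ∧
  (∀ s, (M.enabled s).Nonempty) ∧
  (∀ s, ∀ a ∈ M.enabled s, (M.unc s a).Nonempty)

/-- Cooperative transition `s ⟶ δ`: `δ` lies in the convex hull of the union of the
uncertainty sets of the enabled actions of `s`. -/
def IMDP.trans {S Act AP : Type*} [Fintype S] (M : IMDP S Act AP) (s : S) (δ : S → ℝ) :
    Prop :=
  δ ∈ convexHull ℝ (⋃ a ∈ M.enabled s, M.unc s a)

/-- Probabilistic bisimulation on an IMDP (cooperative semantics). -/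
def IMDP.IsBisim {S Act AP : Type*} [Fintype S] (M : IMDP S Act AP) (R : S → S → Prop) :
    Prop :=
  Equivalence R ∧ ∀ s t, R s t → M.label s = M.label t ∧
    ∀ δ, M.trans s δ → ∃ η, M.trans t η ∧ Lift R δ η

/-- Two states of an IMDP are probabilistically bisimilar (`∼c`). -/
def IMDP.bisimStates {S Act AP : Type*} [Fintype S] (M : IMDP S Act AP) (s t : S) : Prop :=
  ∃ R, M.IsBisim R ∧ R s t

/-- Disjoint union of two IMDPs. -/
def IMDP.disjUnion {S₁ S₂ Act₁ Act₂ AP : Type*}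
    (M₁ : IMDP S₁ Act₁ AP) (M₂ : IMDP S₂ Act₂ AP) : IMDP (S₁ ⊕ S₂) (Act₁ ⊕ Act₂) AP where
  start := Sum.inl M₁.start
  label := Sum.elim M₁.label M₂.label
  low := fun s a t =>
    match s, a, t with
    | Sum.inl s, Sum.inl a, Sum.inl t => M₁.low s a t
    | Sum.inr s, Sum.inr a, Sum.inr t => M₂.low s a t
    | _, _, _ => 0
  high := fun s a t =>
    match s, a, t with
    | Sum.inl s, Sum.inl a, Sum.inl t => M₁.high s a t
    | Sum.inr s, Sum.inr a, Sum.inr t => M₂.high s a t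
    | _, _, _ => 0

/-- Two IMDPs are probabilistically bisimilar (`∼c`): some probabilistic bisimulation on
their disjoint union relates their initial states. -/
def IMDP.Bisimilar {S₁ S₂ Act₁ Act₂ AP : Type*} [Fintype S₁] [Fintype S₂]
    (M₁ : IMDP S₁ Act₁ AP) (M₂ : IMDP S₂ Act₂ AP) : Prop :=
  ∃ R, (M₁.disjUnion M₂).IsBisim R ∧ R (Sum.inl M₁.start) (Sum.inr M₂.start)

/-- Unfolding `UF` of an IMDP as a PA: transitions are the extreme points of the
uncertainty sets of enabled actions. -/
def IMDP.unfold {S Act AP : Type*} [Fintype S] (M : IMDP S Act AP) : PA S AP where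
  start := M.start
  label := M.label
  trans := {p | ∃ a ∈ M.enabled p.1, p.2 ∈ (M.unc p.1 a).extremePoints ℝ}

/-- Folding `F` of a PA as an IMDP with a single action: `I(s,f,t)` is the interval
`[min, max]` of the coordinate-`t` projection of the convex hull of the targets of the
transitions enabled at `s`. -/
def PA.fold {S AP : Type*} [Fintype S] (A : PA S AP) : IMDP S Unit AP where
  start := A.start
  label := A.label
  low := fun s _ t => sInf ((fun δ => δ t) '' convexHull ℝ {η | (s, η) ∈ A.trans})
  high := fun s _ t => sSup ((fun δ => δ t) '' convexHull ℝ {η | (s, η) ∈ A.trans})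

/-- Synchronous product of IMDPs: `M₁ ⊗ M₂ = F(UF(M₁) ⊗ UF(M₂))`. -/
def IMDP.syncProd {S₁ S₂ Act₁ Act₂ AP : Type*} [Fintype S₁] [Fintype S₂]
    (M₁ : IMDP S₁ Act₁ AP) (M₂ : IMDP S₂ Act₂ AP) : IMDP (S₁ × S₂) Unit AP :=
  (M₁.unfold.syncProd M₂.unfold).fold

/-- Interleaved composition `M_l ||| M_r` of IMDPs. -/
def IMDP.interleave {S₁ S₂ Act₁ Act₂ AP : Type*}
    (Ml : IMDP S₁ Act₁ AP) (Mr : IMDP S₂ Act₂ AP) : IMDP (S₁ × S₂) (Act₁ ⊕ Act₂) AP where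
  start := (Ml.start, Mr.start)
  label := fun p => Ml.label p.1 ∪ Mr.label p.2
  low := fun s a t =>
    match a with
    | Sum.inl a => if t.2 = s.2 then Ml.low s.1 a t.1 else 0
    | Sum.inr a => if t.1 = s.1 then Mr.low s.2 a t.2 else 0
  high := fun s a t =>
    match a with
    | Sum.inl a => if t.2 = s.2 then Ml.high s.1 a t.1 else 0
    | Sum.inr a => if t.1 = s.1 then Mr.high s.2 a t.2 else 0

/-- The polytope `CT_R(u)` of class-lifted target distributions of the transitions
enabled at `u`, represented by the map `x ↦ δ([x]_R)` in `ℝ^S`. -/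
def PA.CT {S AP : Type*} [Fintype S] (A : PA S AP) (R : S → S → Prop) (u : S) :
    Set (S → ℝ) :=
  convexHull ℝ ((fun δ => classSum R δ) '' {δ | (u, δ) ∈ A.trans})

/-- The class-lifted distribution `[δ]_R ∈ Disc(S/R)`. -/
def qlift {S : Type*} [Fintype S] (R : Setoid S) (δ : S → ℝ) : Quotient R → ℝ :=
  fun C => ∑ y, if Quotient.mk R y = C then δ y else 0

/-- The polytope `CT_R(u)` of class-lifted target distributions, as a subset of
`ℝ^(S/R)`. -/
def PA.CTq {S AP : Type*} [Fintype S] (A : PA S AP) (R : Setoid S) (u : S) :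
    Set (Quotient R → ℝ) :=
  convexHull ℝ (qlift R '' {δ | (u, δ) ∈ A.trans})

/-- The coordinate-`C` projection interval `[min, max]` of a polytope `P ⊆ ℝ^Q`. -/
def projInterval {Q : Type*} (P : Set (Q → ℝ)) (C : Q) : Set ℝ :=
  Set.Icc (sInf ((fun f => f C) '' P)) (sSup ((fun f => f C) '' P))

/-- The box `∏_C proj_C(P)` in `ℝ^Q` formed by the coordinate projection intervals. -/
def projBox {Q : Type*} (P : Set (Q → ℝ)) : Set (Q → ℝ) :=
  {f | ∀ C, f C ∈ projInterval P C}

/-- The standard probability simplex in `ℝ^Q`. -/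
def stdSimplex' (Q : Type*) : Set (Q → ℝ) :=
  {f | (∀ C, 0 ≤ f C) ∧ ∑ᶠ C, f C = 1}

/-- The product relation `R × id_Y` on `X × Y`. -/
def prodIdRel {X Y : Type*} (R : X → X → Prop) : (X × Y) → (X × Y) → Prop :=
  fun p q => R p.1 q.1 ∧ p.2 = q.2

end

theorem classSum_prodIdRel {X Y : Type*} [Fintype X] [Fintype Y] (R : X → X → Prop)
    (δ : X → ℝ) (ε : Y → ℝ) (p : X × Y) :
    classSum (prodIdRel R) (distProd δ ε) p = classSum R δ p.1 * ε p.2 := by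
  simp only [classSum, prodIdRel, distProd, Fintype.sum_prod_type, Finset.sum_mul]
  refine Finset.sum_congr rfl fun x _ => ?_
  by_cases h : R p.1 x <;> simp [h]

theorem Lift.distProd {X Y : Type*} [Fintype X] [Fintype Y] {R : X → X → Prop}
    {δ₁ δ₂ : X → ℝ} (h : Lift R δ₁ δ₂) (ε : Y → ℝ) :
    Lift (prodIdRel R) (distProd δ₁ ε) (distProd δ₂ ε) := fun p => by
  rw [classSum_prodIdRel, classSum_prodIdRel, h]

theorem Equivalence.prodIdRel {X Y : Type*} {R : X → X → Prop} (h : Equivalence R) :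
    Equivalence (prodIdRel (Y := Y) R) :=
  ⟨fun p => ⟨h.refl p.1, rfl⟩, fun hp => ⟨h.symm hp.1, hp.2.symm⟩,
    fun hp hq => ⟨h.trans hp.1 hq.1, hp.2.trans hq.2⟩⟩

theorem PA.ctrans.syncProd {S T AP : Type*} {A : PA S AP} {B : PA T AP} {s : S} {t : T}
    {η : S → ℝ} {ε : T → ℝ} (h : A.ctrans s η) (ht : (t, ε) ∈ B.trans) :
    (A.syncProd B).ctrans (s, t) (distProd η ε) := by
  obtain ⟨n, p, η, hp, hη, hsum, rfl⟩ := h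
  refine ⟨n, p, fun i => distProd (η i) ε, hp, fun i => ⟨_, hη i, _, ht, rfl⟩, hsum, ?_⟩
  ext x
  simp [distProd, Finset.sum_mul, mul_assoc]

theorem PA.IsBisim.syncProd {S T AP : Type*} [Fintype S] [Fintype T] {A : PA S AP}
    {R : S → S → Prop} (h : A.IsBisim R) (B : PA T AP) :
    (A.syncProd B).IsBisim (prodIdRel R) := by
  refine ⟨h.1.prodIdRel, ?_⟩
  rintro ⟨s, u⟩ ⟨t, v⟩ ⟨hst, huv⟩
  obtain rfl : u = v := huv
  obtain ⟨hl, hstep⟩ := h.2 s t hst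
  refine ⟨congrArg (· ∪ B.label u) hl, ?_⟩
  rintro _ ⟨⟨s', δ⟩, hδ, ⟨u', ε⟩, hε, heq⟩
  obtain ⟨⟨rfl, rfl⟩, rfl⟩ : (s = s' ∧ u = u') ∧ _ = distProd δ ε := by
    simpa only [Prod.mk.injEq] using heq
  obtain ⟨η, hη, hlift⟩ := hstep δ hδ
  exact ⟨_, hη.syncProd hε, hlift.distProd ε⟩

theorem PA.IsBisim.of_equiv {S T AP : Type*} [Fintype S] [Fintype T] {A : PA S AP}
    {B : PA T AP} {R : S → S → Prop} (h : A.IsBisim R) (e : T ≃ S)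
    (hlabel : ∀ t, B.label t = A.label (e t))
    (htrans : ∀ t δ, (e t, δ) ∈ A.trans ↔ (t, δ ∘ e) ∈ B.trans) :
    B.IsBisim fun t t' => R (e t) (e t') := by
  refine ⟨h.1.comap e, fun s t hst => ⟨?_, fun δ hδ => ?_⟩⟩
  · rw [hlabel, hlabel, (h.2 _ _ hst).1]
  · have hclass : ∀ (θ : S → ℝ) t,
        classSum (fun t t' => R (e t) (e t')) (θ ∘ e) t = classSum R θ (e t) := fun θ t =>
      e.sum_comp fun y => if R (e t) y then θ y else 0
    have hδe : (δ ∘ e.symm) ∘ e = δ := by ext; simp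
    obtain ⟨_, ⟨n, p, η, hp, hη, hsum, rfl⟩, hlift⟩ :=
      (h.2 _ _ hst).2 (δ ∘ e.symm) ((htrans _ _).2 (hδe.symm ▸ hδ))
    refine ⟨(∑ i, p i • η i) ∘ e, ⟨n, p, fun i => η i ∘ e, hp,
      fun i => (htrans _ _).1 (hη i), hsum, ?_⟩, fun x => ?_⟩
    · ext; simp
    · rw [← hδe, hclass, hclass, hlift]

theorem PA.disjUnion_syncProd_trans_iff {S₁ S₂ S₃ AP : Type*} (A₁ : PA S₁ AP) (A₂ : PA S₂ AP)
    (A₃ : PA S₃ AP) (t : S₁ × S₃ ⊕ S₂ × S₃) (δ : (S₁ ⊕ S₂) × S₃ → ℝ) :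
    ((Equiv.sumProdDistrib S₁ S₂ S₃).symm t, δ) ∈ ((A₁.disjUnion A₂).syncProd A₃).trans ↔
      (t, δ ∘ (Equiv.sumProdDistrib S₁ S₂ S₃).symm) ∈
        ((A₁.syncProd A₃).disjUnion (A₂.syncProd A₃)).trans := by
  have hl (ε₁ : S₁ → ℝ) (ε₃ : S₃ → ℝ) :
      distProd (Sum.elim ε₁ fun _ : S₂ => (0 : ℝ)) ε₃ ∘ (Equiv.sumProdDistrib S₁ S₂ S₃).symm =
        Sum.elim (distProd ε₁ ε₃) fun _ => 0 := by
    ext (_ | _) <;> simp [distProd]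
  have hr (ε₂ : S₂ → ℝ) (ε₃ : S₃ → ℝ) :
      distProd (Sum.elim (fun _ : S₁ => (0 : ℝ)) ε₂) ε₃ ∘ (Equiv.sumProdDistrib S₁ S₂ S₃).symm =
        Sum.elim (fun _ => 0) (distProd ε₂ ε₃) := by
    ext (_ | _) <;> simp [distProd]
  have hinj := (Equiv.sumProdDistrib S₁ S₂ S₃).symm.surjective.injective_comp_right (γ := ℝ)
  constructor
  · rintro ⟨_, ⟨⟨s, ε⟩, hs, rfl⟩ | ⟨⟨s, ε⟩, hs, rfl⟩, ⟨u, ε₃⟩, hu, heq⟩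
    all_goals
      obtain ⟨ht, rfl⟩ := Prod.mk.inj heq
      rw [Equiv.symm_apply_eq] at ht
      subst ht
    · exact Or.inl ⟨_, ⟨_, hs, _, hu, rfl⟩, by rw [hl]; rfl⟩
    · exact Or.inr ⟨_, ⟨_, hs, _, hu, rfl⟩, by rw [hr]; rfl⟩
  · rintro (⟨_, ⟨⟨s, ε⟩, hs, ⟨u, ε₃⟩, hu, rfl⟩, heq⟩ | ⟨_, ⟨⟨s, ε⟩, hs, ⟨u, ε₃⟩, hu, rfl⟩, heq⟩)
    all_goals
      obtain ⟨rfl, hδ⟩ := Prod.mk.inj heq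
    · obtain rfl := hinj ((hl ε ε₃).trans hδ)
      exact ⟨_, Or.inl ⟨_, hs, rfl⟩, _, hu, rfl⟩
    · obtain rfl := hinj ((hr ε ε₃).trans hδ)
      exact ⟨_, Or.inr ⟨_, hs, rfl⟩, _, hu, rfl⟩

/-- `∼paa` is preserved by the synchronous product of probabilistic
automata: if `A₁ ∼paa A₂` then `A₁ ⊗ A₃ ∼paa A₂ ⊗ A₃`. -/
theorem pa_bisimilar_syncProd {S₁ S₂ S₃ AP : Type*}
    [Fintype S₁] [Fintype S₂] [Fintype S₃]
    (A₁ : PA S₁ AP) (A₂ : PA S₂ AP) (A₃ : PA S₃ AP)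
    (h₁ : A₁.WF) (h₂ : A₂.WF) (h₃ : A₃.WF)
    (h : A₁.Bisimilar A₂) :
    (A₁.syncProd A₃).Bisimilar (A₂.syncProd A₃) := by
  obtain ⟨R, hR, hstart⟩ := h
  refine ⟨_, (hR.syncProd A₃).of_equiv (Equiv.sumProdDistrib S₁ S₂ S₃).symm ?_
    (PA.disjUnion_syncProd_trans_iff A₁ A₂ A₃), hstart, rfl⟩
  rintro (_ | _) <;> rfl
end

section
/- Probabilistic bisimilarity of interval Markov decision processes is transitive: for IMDPs M₁, M₂, M₃, if M₁ ∼c M₂ and M₂ ∼c M₃, then M₁ ∼c M₃. -/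
open scoped Classical

namespace IMDP

/-- A state of the left summand moves in a disjoint union exactly as it does in the left IMDP. -/
theorem disjUnion_trans_inl {S₁ S₂ Act₁ Act₂ AP : Type*} [Fintype S₁] [Fintype S₂]
    (M₁ : IMDP S₁ Act₁ AP) (M₂ : IMDP S₂ Act₂ AP) (s : S₁) :
    {δ | (M₁.disjUnion M₂).trans (Sum.inl s) δ} =
      (fun δ => Sum.elim δ (fun _ => (0 : ℝ))) '' {δ | M₁.trans s δ} := by
  let F : (S₁ → ℝ) →ₗ[ℝ] (S₁ ⊕ S₂ → ℝ) :=
    { toFun := fun δ => Sum.elim δ (fun _ => 0)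
      map_add' := fun f g => by ext (x | x) <;> simp
      map_smul' := fun c f => by ext (x | x) <;> simp }
  have hU : (⋃ a ∈ (M₁.disjUnion M₂).enabled (Sum.inl s), (M₁.disjUnion M₂).unc (Sum.inl s) a) =
      F '' ⋃ a ∈ M₁.enabled s, M₁.unc s a := by
    ext δ
    simp only [Set.mem_iUnion, Set.mem_image, exists_prop]
    constructor
    · rintro ⟨a | a, ⟨t | t, ht⟩, ⟨h0, h1⟩, hI⟩
      · have hz : ∀ y, δ (Sum.inr y) = 0 := fun y => le_antisymm (hI (Sum.inr y)).2 (h0 _)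
        refine ⟨fun y => δ (Sum.inl y), ⟨a, ⟨t, ht⟩, ⟨fun y => h0 _, ?_⟩,
          fun y => hI (Sum.inl y)⟩, ?_⟩
        · simpa [hz] using h1
        · ext (y | y)
          · rfl
          · exact (hz y).symm
      all_goals exact absurd ⟨rfl, rfl⟩ ht
    · rintro ⟨δ, ⟨a, ⟨t, ht⟩, ⟨h0, h1⟩, hI⟩, rfl⟩
      refine ⟨Sum.inl a, ⟨Sum.inl t, ht⟩, ⟨?_, ?_⟩, ?_⟩
      · rintro (y | y)
        · exact h0 y
        · exact le_rfl
      · simpa [F] using h1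
      · rintro (y | y)
        · exact hI y
        · exact ⟨le_rfl, le_rfl⟩
  change convexHull ℝ _ = F '' convexHull ℝ _
  rw [hU, F.image_convexHull]

/-- A state of the right summand moves in a disjoint union exactly as it does in the right IMDP. -/
theorem disjUnion_trans_inr {S₁ S₂ Act₁ Act₂ AP : Type*} [Fintype S₁] [Fintype S₂]
    (M₁ : IMDP S₁ Act₁ AP) (M₂ : IMDP S₂ Act₂ AP) (s : S₂) :
    {δ | (M₁.disjUnion M₂).trans (Sum.inr s) δ} =
      (fun δ => Sum.elim (fun _ => (0 : ℝ)) δ) '' {δ | M₂.trans s δ} := by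
  let F : (S₂ → ℝ) →ₗ[ℝ] (S₁ ⊕ S₂ → ℝ) :=
    { toFun := fun δ => Sum.elim (fun _ => 0) δ
      map_add' := fun f g => by ext (x | x) <;> simp
      map_smul' := fun c f => by ext (x | x) <;> simp }
  have hU : (⋃ a ∈ (M₁.disjUnion M₂).enabled (Sum.inr s), (M₁.disjUnion M₂).unc (Sum.inr s) a) =
      F '' ⋃ a ∈ M₂.enabled s, M₂.unc s a := by
    ext δ
    simp only [Set.mem_iUnion, Set.mem_image, exists_prop]
    constructor
    · rintro ⟨a | a, ⟨t | t, ht⟩, ⟨h0, h1⟩, hI⟩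
      on_goal 4 =>
        have hz : ∀ y, δ (Sum.inl y) = 0 := fun y => le_antisymm (hI (Sum.inl y)).2 (h0 _)
        refine ⟨fun y => δ (Sum.inr y), ⟨a, ⟨t, ht⟩, ⟨fun y => h0 _, ?_⟩,
          fun y => hI (Sum.inr y)⟩, ?_⟩
        · simpa [hz] using h1
        · ext (y | y)
          · exact (hz y).symm
          · rfl
      all_goals exact absurd ⟨rfl, rfl⟩ ht
    · rintro ⟨δ, ⟨a, ⟨t, ht⟩, ⟨h0, h1⟩, hI⟩, rfl⟩
      refine ⟨Sum.inr a, ⟨Sum.inr t, ht⟩, ⟨?_, ?_⟩, ?_⟩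
      · rintro (y | y)
        · exact le_rfl
        · exact h0 y
      · simpa [F] using h1
      · rintro (y | y)
        · exact ⟨le_rfl, le_rfl⟩
        · exact hI y
  change convexHull ℝ _ = F '' convexHull ℝ _
  rw [hU, F.image_convexHull]

/-- The masses that `δ`, transported along `j`, gives to the classes of `E`. -/
noncomputable def classMass {S T : Type*} [Fintype S] (E : T → T → Prop) (j : S → T)
    (δ : S → ℝ) (t : T) : ℝ :=
  ∑ y, if E t (j y) then δ y else 0

/-- The class masses reachable from `s` by a cooperative transition of `M`. -/
def classMoves {S T Act AP : Type*} [Fintype S] (M : IMDP S Act AP) (E : T → T → Prop)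
    (j : S → T) (s : S) : Set (T → ℝ) :=
  classMass E j '' {δ | M.trans s δ}

theorem classMoves_disjUnion {S₁ S₂ T Act₁ Act₂ AP : Type*} [Fintype S₁] [Fintype S₂]
    (M₁ : IMDP S₁ Act₁ AP) (M₂ : IMDP S₂ Act₂ AP) (E : T → T → Prop) (j : S₁ ⊕ S₂ → T) :
    (M₁.disjUnion M₂).classMoves E j =
      Sum.elim (M₁.classMoves E (j ∘ Sum.inl)) (M₂.classMoves E (j ∘ Sum.inr)) := by
  ext (s | s) : 1
  · simp only [classMoves, disjUnion_trans_inl, Set.image_image, Sum.elim_inl]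
    congr! 1
    ext δ
    simp [classMass]
  · simp only [classMoves, disjUnion_trans_inr, Set.image_image, Sum.elim_inr]
    congr! 1
    ext δ
    simp [classMass]

end IMDP

/-- Distributions related by `Lift R` have equal mass on every `R`-invariant set. -/
theorem Lift.sum_eq {S : Type*} [Fintype S] {R : S → S → Prop} (hR : Equivalence R)
    {δ η : S → ℝ} (h : Lift R δ η) {P : S → Prop} (hP : ∀ x y, R x y → (P x ↔ P y)) :
    (∑ y, if P y then δ y else 0) = ∑ y, if P y then η y else 0 := by
  let r : Setoid S := ⟨R, hR⟩
  rw [← Finset.sum_fiberwise Finset.univ (Quotient.mk r),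
    ← Finset.sum_fiberwise Finset.univ (Quotient.mk r) (fun y => if P y then η y else 0)]
  refine Finset.sum_congr rfl fun q _ => ?_
  induction q using Quotient.inductionOn with | _ x
  have key : ∀ f : S → ℝ,
      (∑ y with Quotient.mk r y = Quotient.mk r x, if P y then f y else 0) =
        if P x then classSum R f x else 0 := by
    intro f
    have hmem : ∀ y, Quotient.mk r y = Quotient.mk r x ↔ R x y := fun y =>
      Quotient.eq.trans ⟨fun e => hR.symm e, fun e => hR.symm e⟩
    simp only [hmem, Finset.sum_filter, classSum]
    split_ifs with hx
    · refine Finset.sum_congr rfl fun y _ => ?_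
      by_cases hy : R x y <;> simp [hy, ← hP x y, hx]
    · refine Finset.sum_eq_zero fun y _ => ?_
      by_cases hy : R x y <;> simp [hy, ← hP x y, hx]
  rw [key, key, h x]

namespace IMDP

/-- Along a map sending a bisimulation into a coarser equivalence, related states have the same
class moves. -/
theorem IsBisim.classMoves_eq {S T Act AP : Type*} [Fintype S] {M : IMDP S Act AP}
    {R : S → S → Prop} (h : M.IsBisim R) {E : T → T → Prop} (hE : Equivalence E) {j : S → T}
    (hRE : ∀ x y, R x y → E (j x) (j y)) {s t : S} (hst : R s t) :
    M.classMoves E j s = M.classMoves E j t := by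
  have sub : ∀ s t, R s t → M.classMoves E j s ⊆ M.classMoves E j t := by
    rintro s t hst _ ⟨δ, hδ, rfl⟩
    obtain ⟨η, hη, hl⟩ := (h.2 s t hst).2 δ hδ
    refine ⟨η, hη, funext fun u => (hl.sum_eq h.1 fun x y hxy => ?_).symm⟩
    exact ⟨fun e => hE.trans e (hRE x y hxy), fun e => hE.trans e (hE.symm (hRE x y hxy))⟩
  exact (sub s t hst).antisymm (sub t s (h.1.symm hst))

/-- Pulling back an equivalence that respects labels and class moves gives a bisimulation. -/
theorem isBisim_comap {S T Act AP : Type*} [Fintype S] {M : IMDP S Act AP} {E : T → T → Prop}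
    (hE : Equivalence E) (j : S → T)
    (h : ∀ s t, E (j s) (j t) → M.label s = M.label t ∧
      M.classMoves E j s = M.classMoves E j t) :
    M.IsBisim fun s t => E (j s) (j t) := by
  refine ⟨hE.comap j, fun s t hst => ⟨(h s t hst).1, fun δ hδ => ?_⟩⟩
  have hmem : classMass E j δ ∈ M.classMoves E j t := (h s t hst).2 ▸ ⟨δ, hδ, rfl⟩
  obtain ⟨η, hη, he⟩ := hmem
  exact ⟨η, hη, fun x => (congrFun he (j x)).symm⟩

end IMDP

/-- probabilistic bisimilarity of IMDPs is transitive. -/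
theorem imdp_bisimilar_trans {S₁ S₂ S₃ Act₁ Act₂ Act₃ AP : Type*}
    [Fintype S₁] [Fintype S₂] [Fintype S₃] [Fintype Act₁] [Fintype Act₂] [Fintype Act₃]
    (M₁ : IMDP S₁ Act₁ AP) (M₂ : IMDP S₂ Act₂ AP) (M₃ : IMDP S₃ Act₃ AP)
    (h₁ : M₁.WF) (h₂ : M₂.WF) (h₃ : M₃.WF)
    (h12 : M₁.Bisimilar M₂) (h23 : M₂.Bisimilar M₃) :
    M₁.Bisimilar M₃ := by
  obtain ⟨R, hR, hR0⟩ := h12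
  obtain ⟨Q, hQ, hQ0⟩ := h23
  let j₁₂ : S₁ ⊕ S₂ → S₁ ⊕ S₂ ⊕ S₃ := Sum.elim Sum.inl (Sum.inr ∘ Sum.inl)
  let j₂₃ : S₂ ⊕ S₃ → S₁ ⊕ S₂ ⊕ S₃ := Sum.inr
  let j₁₃ : S₁ ⊕ S₃ → S₁ ⊕ S₂ ⊕ S₃ := Sum.elim Sum.inl (Sum.inr ∘ Sum.inr)
  let B : S₁ ⊕ S₂ ⊕ S₃ → S₁ ⊕ S₂ ⊕ S₃ → Prop := fun u v =>
    Relation.Map R j₁₂ j₁₂ u v ∨ Relation.Map Q j₂₃ j₂₃ u v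
  let E := Relation.EqvGen B
  have hE : Equivalence E := Relation.EqvGen.is_equivalence B
  have hRE : ∀ x y, R x y → E (j₁₂ x) (j₁₂ y) := fun x y h =>
    .rel _ _ (.inl ⟨x, y, h, rfl, rfl⟩)
  have hQE : ∀ x y, Q x y → E (j₂₃ x) (j₂₃ y) := fun x y h =>
    .rel _ _ (.inr ⟨x, y, h, rfl, rfl⟩)
  let lab : S₁ ⊕ S₂ ⊕ S₃ → Set AP := Sum.elim M₁.label (Sum.elim M₂.label M₃.label)
  let V : S₁ ⊕ S₂ ⊕ S₃ → Set (S₁ ⊕ S₂ ⊕ S₃ → ℝ) :=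
    Sum.elim (M₁.classMoves E Sum.inl)
      (Sum.elim (M₂.classMoves E (Sum.inr ∘ Sum.inl)) (M₃.classMoves E (Sum.inr ∘ Sum.inr)))
  have hV₁₂ : ∀ x, (M₁.disjUnion M₂).label x = lab (j₁₂ x) ∧
      (M₁.disjUnion M₂).classMoves E j₁₂ x = V (j₁₂ x) := by
    rw [IMDP.classMoves_disjUnion]
    rintro (x | x) <;> exact ⟨rfl, rfl⟩
  have hV₂₃ : ∀ x, (M₂.disjUnion M₃).label x = lab (j₂₃ x) ∧
      (M₂.disjUnion M₃).classMoves E j₂₃ x = V (j₂₃ x) := by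
    rw [IMDP.classMoves_disjUnion]
    rintro (x | x) <;> exact ⟨rfl, rfl⟩
  have hV₁₃ : ∀ x, (M₁.disjUnion M₃).label x = lab (j₁₃ x) ∧
      (M₁.disjUnion M₃).classMoves E j₁₃ x = V (j₁₃ x) := by
    rw [IMDP.classMoves_disjUnion]
    rintro (x | x) <;> exact ⟨rfl, rfl⟩
  have hinv : ∀ u v, E u v → lab u = lab v ∧ V u = V v := by
    intro u v huv
    induction huv with
    | rel u v h =>
      rcases h with ⟨x, y, h, rfl, rfl⟩ | ⟨x, y, h, rfl, rfl⟩
      · rw [← (hV₁₂ x).1, ← (hV₁₂ y).1, ← (hV₁₂ x).2, ← (hV₁₂ y).2]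
        exact ⟨(hR.2 x y h).1, hR.classMoves_eq hE hRE h⟩
      · rw [← (hV₂₃ x).1, ← (hV₂₃ y).1, ← (hV₂₃ x).2, ← (hV₂₃ y).2]
        exact ⟨(hQ.2 x y h).1, hQ.classMoves_eq hE hQE h⟩
    | refl u => exact ⟨rfl, rfl⟩
    | symm u v _ ih => exact ⟨ih.1.symm, ih.2.symm⟩
    | trans u v w _ _ ih₁ ih₂ => exact ⟨ih₁.1.trans ih₂.1, ih₁.2.trans ih₂.2⟩
  refine ⟨fun x y => E (j₁₃ x) (j₁₃ y), IMDP.isBisim_comap hE j₁₃ fun s t hst => ?_,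
    hE.trans (hRE _ _ hR0) (hQE _ _ hQ0)⟩
  rw [(hV₁₃ s).1, (hV₁₃ t).1, (hV₁₃ s).2, (hV₁₃ t).2]
  exact hinv _ _ hst
end

section
/- The unfolding mapping preserves probabilistic bisimilarity: for IMDPs M₁ and M₂, if M₁ ∼c M₂ then the unfolded probabilistic automata satisfy UF(M₁) ∼paa UF(M₂). -/
open scoped Classical

open Filter Topology in
/-- A lower bound on `x` persists along a small perturbation in direction `d`, provided
`d` vanishes whenever the bound is tight. -/
lemma eventually_le_add_mul {a x d : ℝ} (hx : a ≤ x) (hd : x = a → d = 0) :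
    ∀ᶠ ε in 𝓝 (0 : ℝ), a ≤ x + ε * d := by
  rcases hx.eq_or_lt with h | h
  · simp [hd h.symm, h]
  · have hc : Tendsto (fun ε : ℝ => x + ε * d) (𝓝 0) (𝓝 x) :=
      Continuous.tendsto' (by fun_prop) _ _ (by simp)
    exact (hc.eventually_const_lt h).mono fun _ => le_of_lt

namespace IMDP

section Polytope

variable {S Act AP : Type*} [Fintype S] (M : IMDP S Act AP) (s : S) (a : Act)

lemma unc_eq_inter :
    M.unc s a = Set.Icc (M.low s a) (M.high s a) ∩ stdSimplex ℝ S := by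
  ext δ
  simp only [unc, IsDist, stdSimplex, Set.mem_inter_iff, Set.mem_Icc, Set.mem_ofPred_eq,
    Pi.le_def, forall_and]
  tauto

lemma convex_unc : Convex ℝ (M.unc s a) := by
  rw [unc_eq_inter]
  exact (convex_Icc _ _).inter (convex_stdSimplex ℝ S)

lemma isCompact_unc : IsCompact (M.unc s a) := by
  rw [unc_eq_inter]
  exact isCompact_Icc.inter (isCompact_stdSimplex ℝ S)

open Filter Topology in
/-- An extreme point of an uncertainty set is determined by its tight constraints. -/
lemma eq_of_mem_extremePoints_unc {x y : S → ℝ}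
    (hx : x ∈ (M.unc s a).extremePoints ℝ) (hy : y ∈ M.unc s a)
    (h0 : ∀ t, x t = 0 → y t = 0)
    (hl : ∀ t, x t = M.low s a t → y t = M.low s a t)
    (hh : ∀ t, x t = M.high s a t → y t = M.high s a t) : x = y := by
  set d : S → ℝ := x - y with hd
  have hxm := hx.1
  have key : ∀ᶠ ε in 𝓝 (0 : ℝ), x + ε • d ∈ M.unc s a := by
    have e0 : ∀ᶠ ε in 𝓝 (0 : ℝ), ∀ t, 0 ≤ x t + ε * d t :=
      eventually_all.2 fun t => eventually_le_add_mul (hxm.1.1 t) fun h => by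
        simp [hd, h, h0 t h]
    have el : ∀ᶠ ε in 𝓝 (0 : ℝ), ∀ t, M.low s a t ≤ x t + ε * d t :=
      eventually_all.2 fun t => eventually_le_add_mul (hxm.2 t).1 fun h => by
        simp [hd, h, hl t h]
    have eh : ∀ᶠ ε in 𝓝 (0 : ℝ), ∀ t, -M.high s a t ≤ -x t + ε * -d t :=
      eventually_all.2 fun t => eventually_le_add_mul (neg_le_neg (hxm.2 t).2) fun h => by
        have h := neg_injective h
        simp [hd, h, hh t h]
    filter_upwards [e0, el, eh] with ε h0 hl hh
    refine ⟨⟨h0, ?_⟩, fun t => ⟨hl t, ?_⟩⟩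
    · simp [hd, Finset.sum_add_distrib, ← Finset.mul_sum, hxm.1.2, hy.1.2]
    · have := hh t
      simp only [Pi.add_apply, Pi.smul_apply, smul_eq_mul]
      linarith
  have key' : ∀ᶠ ε in 𝓝 (0 : ℝ), x + (-ε) • d ∈ M.unc s a :=
    (Continuous.tendsto' continuous_neg (0 : ℝ) 0 neg_zero).eventually key
  obtain ⟨ε, ⟨hp, hn⟩, hε⟩ :=
    (((key.and key').filter_mono nhdsWithin_le_nhds).and
      (self_mem_nhdsWithin : Set.Ioi (0 : ℝ) ∈ 𝓝[>] 0)).exists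
  have hseg : x ∈ openSegment ℝ (x + ε • d) (x + (-ε) • d) :=
    ⟨1 / 2, 1 / 2, by norm_num, by norm_num, by norm_num, by module⟩
  have hz : ε • d = 0 := by simpa using hx.2 hp hn hseg
  exact sub_eq_zero.1 ((smul_eq_zero.1 hz).resolve_left (ne_of_gt hε))

lemma finite_extremePoints_unc : ((M.unc s a).extremePoints ℝ).Finite := by
  let tight : (S → ℝ) → S → Prop × Prop × Prop := fun x t =>
    (x t = 0, x t = M.low s a t, x t = M.high s a t)
  refine Set.Finite.of_finite_image (f := tight) (Set.toFinite _) fun x hx y hy h => ?_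
  have ht : ∀ t, tight x t = tight y t := congrFun h
  simp only [tight, Prod.mk.injEq, eq_iff_iff] at ht
  exact M.eq_of_mem_extremePoints_unc s a hx hy.1 (fun t => (ht t).1.1)
    (fun t => (ht t).2.1.1) (fun t => (ht t).2.2.1)

lemma convexHull_extremePoints_unc :
    convexHull ℝ ((M.unc s a).extremePoints ℝ) = M.unc s a := by
  rw [← ((M.finite_extremePoints_unc s a).isClosed_convexHull ℝ).closure_eq]
  exact closure_convexHull_extremePoints (M.isCompact_unc s a) (M.convex_unc s a)

end Polytope

end IMDP

lemma PA.ctrans_iff_mem_convexHull {S AP : Type*} (A : PA S AP) (s : S) (δ : S → ℝ) :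
    A.ctrans s δ ↔ δ ∈ convexHull ℝ {η | (s, η) ∈ A.trans} := by
  rw [mem_convexHull_iff_exists_fintype]
  constructor
  · rintro ⟨n, p, η, hp, hη, hs, rfl⟩
    exact ⟨Fin n, inferInstance, p, η, hp, hs, hη, rfl⟩
  · rintro ⟨ι, _, p, η, hp, hs, hη, rfl⟩
    let e := (Fintype.equivFin ι).symm
    exact ⟨Fintype.card ι, p ∘ e, η ∘ e, fun i => hp _, fun i => hη _,
      (e.sum_comp p).trans hs, (e.sum_comp fun i => p i • η i).symm⟩

namespace IMDP

lemma trans_iff_ctrans_unfold {S Act AP : Type*} [Fintype S] (M : IMDP S Act AP) (s : S)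
    (δ : S → ℝ) : M.trans s δ ↔ M.unfold.ctrans s δ := by
  rw [PA.ctrans_iff_mem_convexHull, trans]
  suffices h : convexHull ℝ (⋃ a ∈ M.enabled s, M.unc s a) =
      convexHull ℝ {η | (s, η) ∈ M.unfold.trans} by rw [h]
  refine (convexHull_min (Set.iUnion₂_subset fun a ha => ?_) (convex_convexHull ℝ _)).antisymm
    (convexHull_mono ?_)
  · rw [← convexHull_extremePoints_unc]
    exact convexHull_mono fun η hη => ⟨a, ha, hη⟩
  · rintro η ⟨a, ha, hη⟩
    exact Set.mem_biUnion ha hη.1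

lemma IsBisim.unfold {S Act AP : Type*} [Fintype S] {M : IMDP S Act AP} {R : S → S → Prop}
    (h : M.IsBisim R) : M.unfold.IsBisim R := by
  refine ⟨h.1, fun s t hst => ⟨(h.2 s t hst).1, fun δ hδ => ?_⟩⟩
  obtain ⟨a, ha, hδ⟩ := hδ
  obtain ⟨η, hη, hl⟩ := (h.2 s t hst).2 δ
    (subset_convexHull ℝ _ (Set.mem_biUnion ha hδ.1))
  exact ⟨η, (M.trans_iff_ctrans_unfold t η).1 hη, hl⟩

end IMDP

/-- An injective linear map commutes with taking extreme points. -/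
lemma LinearMap.extremePoints_image_of_injective {E F : Type*} [AddCommGroup E] [Module ℝ E]
    [AddCommGroup F] [Module ℝ F] (f : E →ₗ[ℝ] F) (hf : Function.Injective f) (A : Set E) :
    (f '' A).extremePoints ℝ = f '' A.extremePoints ℝ := by
  have hseg : ∀ x y, f '' openSegment ℝ x y = openSegment ℝ (f x) (f y) :=
    image_openSegment _ f.toAffineMap
  ext b
  constructor
  · rintro ⟨⟨x, hx, rfl⟩, h⟩
    refine ⟨x, ⟨hx, fun y hy z hz hxyz => hf ?_⟩, rfl⟩
    exact h ⟨y, hy, rfl⟩ ⟨z, hz, rfl⟩ (hseg y z ▸ ⟨x, hxyz, rfl⟩)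
  · rintro ⟨x, ⟨hx, h⟩, rfl⟩
    refine ⟨⟨x, hx, rfl⟩, ?_⟩
    rintro _ ⟨y, hy, rfl⟩ _ ⟨z, hz, rfl⟩ hxyz
    rw [← hseg, hf.mem_set_image] at hxyz
    exact congrArg f (h hy hz hxyz)

/-- Extension by zero along `Sum.inl`. -/
def extendInl (S₁ S₂ : Type*) : (S₁ → ℝ) →ₗ[ℝ] (S₁ ⊕ S₂ → ℝ) where
  toFun δ := Sum.elim δ fun _ => 0
  map_add' _ _ := by ext (_ | _) <;> simp
  map_smul' _ _ := by ext (_ | _) <;> simp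

/-- Extension by zero along `Sum.inr`. -/
def extendInr (S₁ S₂ : Type*) : (S₂ → ℝ) →ₗ[ℝ] (S₁ ⊕ S₂ → ℝ) where
  toFun δ := Sum.elim (fun _ => 0) δ
  map_add' _ _ := by ext (_ | _) <;> simp
  map_smul' _ _ := by ext (_ | _) <;> simp

lemma extendInl_injective (S₁ S₂ : Type*) : Function.Injective (extendInl S₁ S₂) :=
  fun _ _ h => funext fun s => congrFun h (Sum.inl s)

lemma extendInr_injective (S₁ S₂ : Type*) : Function.Injective (extendInr S₁ S₂) :=
  fun _ _ h => funext fun s => congrFun h (Sum.inr s)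

namespace IMDP

section DisjUnion

variable {S₁ S₂ Act₁ Act₂ AP : Type*} (M₁ : IMDP S₁ Act₁ AP) (M₂ : IMDP S₂ Act₂ AP)

lemma enabled_disjUnion_inl (s : S₁) :
    (M₁.disjUnion M₂).enabled (Sum.inl s) = Sum.inl '' M₁.enabled s := by
  ext (a | a) <;> simp [enabled, disjUnion]

lemma enabled_disjUnion_inr (s : S₂) :
    (M₁.disjUnion M₂).enabled (Sum.inr s) = Sum.inr '' M₂.enabled s := by
  ext (a | a) <;> simp [enabled, disjUnion]

variable [Fintype S₁] [Fintype S₂]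

lemma unc_disjUnion_inl (s : S₁) (a : Act₁) :
    (M₁.disjUnion M₂).unc (Sum.inl s) (Sum.inl a) = extendInl S₁ S₂ '' M₁.unc s a := by
  ext δ
  constructor
  · rintro ⟨⟨h0, h1⟩, h⟩
    have hz : ∀ t, δ (Sum.inr t) = 0 := fun t => le_antisymm (h (Sum.inr t)).2 (h0 _)
    refine ⟨δ ∘ Sum.inl, ⟨⟨fun t => h0 _, ?_⟩, fun t => h (Sum.inl t)⟩, ?_⟩
    · simpa [Fintype.sum_sum_type, hz] using h1
    · ext (t | t) <;> simp [extendInl, hz]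
  · rintro ⟨δ, ⟨⟨h0, h1⟩, h⟩, rfl⟩
    refine ⟨⟨?_, ?_⟩, ?_⟩
    · rintro (t | t) <;> simp [extendInl, h0]
    · simpa [Fintype.sum_sum_type, extendInl] using h1
    · rintro (t | t)
      · exact h t
      · simp [extendInl, disjUnion]

lemma unc_disjUnion_inr (s : S₂) (a : Act₂) :
    (M₁.disjUnion M₂).unc (Sum.inr s) (Sum.inr a) = extendInr S₁ S₂ '' M₂.unc s a := by
  ext δ
  constructor
  · rintro ⟨⟨h0, h1⟩, h⟩
    have hz : ∀ t, δ (Sum.inl t) = 0 := fun t => le_antisymm (h (Sum.inl t)).2 (h0 _)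
    refine ⟨δ ∘ Sum.inr, ⟨⟨fun t => h0 _, ?_⟩, fun t => h (Sum.inr t)⟩, ?_⟩
    · simpa [Fintype.sum_sum_type, hz] using h1
    · ext (t | t) <;> simp [extendInr, hz]
  · rintro ⟨δ, ⟨⟨h0, h1⟩, h⟩, rfl⟩
    refine ⟨⟨?_, ?_⟩, ?_⟩
    · rintro (t | t) <;> simp [extendInr, h0]
    · simpa [Fintype.sum_sum_type, extendInr] using h1
    · rintro (t | t)
      · simp [extendInr, disjUnion]
      · exact h t

/-- Unfolding commutes with disjoint unions. -/
lemma unfold_disjUnion :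
    (M₁.disjUnion M₂).unfold = M₁.unfold.disjUnion M₂.unfold := by
  suffices h : (M₁.disjUnion M₂).unfold.trans = (M₁.unfold.disjUnion M₂.unfold).trans from
    congrArg (PA.mk (Sum.inl M₁.start) (Sum.elim M₁.label M₂.label)) h
  ext ⟨s | s, δ⟩
  · constructor
    · rintro ⟨a, ha, hδ⟩
      simp only [enabled_disjUnion_inl] at ha
      obtain ⟨a, ha, rfl⟩ := ha
      simp only [unc_disjUnion_inl, LinearMap.extremePoints_image_of_injective _
        (extendInl_injective S₁ S₂)] at hδ
      obtain ⟨η, hη, rfl⟩ := hδ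
      exact Or.inl ⟨(s, η), ⟨a, ha, hη⟩, rfl⟩
    · rintro (⟨⟨s, η⟩, ⟨a, ha, hη⟩, h⟩ | ⟨_, _, h⟩)
      · obtain ⟨hs, rfl⟩ := Prod.mk.inj h
        obtain rfl := Sum.inl_injective hs
        refine ⟨Sum.inl a, by simpa [enabled_disjUnion_inl] using ha, ?_⟩
        simp only [unc_disjUnion_inl, LinearMap.extremePoints_image_of_injective _
          (extendInl_injective S₁ S₂)]
        exact ⟨η, hη, rfl⟩
      · simp at h
  · constructor
    · rintro ⟨a, ha, hδ⟩
      simp only [enabled_disjUnion_inr] at ha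
      obtain ⟨a, ha, rfl⟩ := ha
      simp only [unc_disjUnion_inr, LinearMap.extremePoints_image_of_injective _
        (extendInr_injective S₁ S₂)] at hδ
      obtain ⟨η, hη, rfl⟩ := hδ
      exact Or.inr ⟨(s, η), ⟨a, ha, hη⟩, rfl⟩
    · rintro (⟨_, _, h⟩ | ⟨⟨s, η⟩, ⟨a, ha, hη⟩, h⟩)
      · simp at h
      · obtain ⟨hs, rfl⟩ := Prod.mk.inj h
        obtain rfl := Sum.inr_injective hs
        refine ⟨Sum.inr a, by simpa [enabled_disjUnion_inr] using ha, ?_⟩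
        simp only [unc_disjUnion_inr, LinearMap.extremePoints_image_of_injective _
          (extendInr_injective S₁ S₂)]
        exact ⟨η, hη, rfl⟩

end DisjUnion

end IMDP

/-- the unfolding mapping preserves probabilistic bisimilarity:
if `M₁ ∼c M₂` then `UF(M₁) ∼paa UF(M₂)`. -/
theorem unfold_preserves_bisimilar {S₁ S₂ Act₁ Act₂ AP : Type*}
    [Fintype S₁] [Fintype S₂] [Fintype Act₁] [Fintype Act₂]
    (M₁ : IMDP S₁ Act₁ AP) (M₂ : IMDP S₂ Act₂ AP)
    (h₁ : M₁.WF) (h₂ : M₂.WF)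
    (h : M₁.Bisimilar M₂) :
    M₁.unfold.Bisimilar M₂.unfold := by
  obtain ⟨R, hR, hstart⟩ := h
  exact ⟨R, M₁.unfold_disjUnion M₂ ▸ hR.unfold, hstart⟩
end

section
/- Probabilistic bisimilarity of IMDPs is a congruence with respect to interleaved composition: for IMDPs M₁, M₂, M₃, if M₁ ∼c M₂, then M₁ ||| M₃ ∼c M₂ ||| M₃. -/
open scoped Classical

/-- The union of the uncertainty sets of the enabled actions of a state. -/
def IMDP.steps {S Act AP : Type*} [Fintype S] (M : IMDP S Act AP) (s : S) : Set (S → ℝ) :=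
  ⋃ a ∈ M.enabled s, M.unc s a

theorem IMDP.mem_steps {S Act AP : Type*} [Fintype S] {M : IMDP S Act AP} {s : S}
    {δ : S → ℝ} : δ ∈ M.steps s ↔ ∃ a ∈ M.enabled s, δ ∈ M.unc s a := by
  simp [IMDP.steps]

/-- Class sums as a linear map in the distribution. -/
noncomputable def classSumLinear {S : Type*} [Fintype S] (R : S → S → Prop) : (S → ℝ) →ₗ[ℝ] (S → ℝ) where
  toFun := classSum R
  map_add' f g := by
    ext x
    simp only [classSum, Pi.add_apply, ← Finset.sum_add_distrib]
    exact Finset.sum_congr rfl fun y _ => by split_ifs <;> simp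
  map_smul' c f := by
    ext x
    simp [classSum, Finset.mul_sum]

theorem lift_iff_classSumLinear {S : Type*} [Fintype S] {R : S → S → Prop} {f g : S → ℝ} :
    Lift R f g ↔ classSumLinear R f = classSumLinear R g :=
  funext_iff.symm

/-- Distributions that can be matched, up to `R`, within a convex set form a convex set. -/
theorem convex_setOf_exists_lift {S : Type*} [Fintype S] (R : S → S → Prop)
    {C : Set (S → ℝ)} (hC : Convex ℝ C) : Convex ℝ {δ | ∃ η ∈ C, Lift R δ η} := by
  have h : {δ | ∃ η ∈ C, Lift R δ η} = classSumLinear R ⁻¹' (classSumLinear R '' C) := by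
    ext δ
    simp only [lift_iff_classSumLinear, Set.mem_ofPred_eq, Set.mem_preimage, Set.mem_image,
      eq_comm]
  rw [h]
  exact (hC.linear_image _).linear_preimage _

theorem classSum_distProd {S T : Type*} [Fintype S] [Fintype T] (R : S → S → Prop)
    (f : S → ℝ) (g : T → ℝ) (p : S × T) :
    classSum (prodIdRel R) (distProd f g) p = classSum R f p.1 * g p.2 := by
  simp only [classSum, prodIdRel, distProd, Fintype.sum_prod_type, Finset.sum_mul]
  refine Finset.sum_congr rfl fun x _ => ?_
  by_cases h : R p.1 x <;> simp [h]

theorem classSum_single {S : Type*} [Fintype S] (R : S → S → Prop) (s x : S) :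
    classSum R (Pi.single s 1) x = if R x s then 1 else 0 := by
  rw [classSum, Finset.sum_eq_single s] <;> simp +contextual

theorem equivalence_prodIdRel {X Y : Type*} {R : X → X → Prop} (hR : Equivalence R) :
    Equivalence (prodIdRel (Y := Y) R) :=
  ⟨fun p => ⟨hR.refl p.1, rfl⟩, fun h => ⟨hR.symm h.1, h.2.symm⟩,
    fun h k => ⟨hR.trans h.1 k.1, h.2.trans k.2⟩⟩

theorem isDist_distProd {S T : Type*} [Fintype S] [Fintype T] {f : S → ℝ} {g : T → ℝ}
    (hf : IsDist f) (hg : IsDist g) : IsDist (distProd f g) := by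
  refine ⟨fun p => mul_nonneg (hf.1 _) (hg.1 _), ?_⟩
  simp only [distProd, Fintype.sum_prod_type, ← Finset.mul_sum, hg.2, mul_one, hf.2]

theorem isDist_single {S : Type*} [Fintype S] (s : S) : IsDist (Pi.single s (1 : ℝ)) := by
  refine ⟨fun x => ?_, by simp⟩
  by_cases h : x = s <;> simp [h]

section interleave

variable {S T Act Act' AP : Type*} {M : IMDP S Act AP} {N : IMDP T Act' AP}

theorem IMDP.inl_mem_enabled_interleave {s : S} {u : T} {a : Act} :
    Sum.inl a ∈ (M.interleave N).enabled (s, u) ↔ a ∈ M.enabled s := by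
  constructor
  · rintro ⟨⟨t, v⟩, h⟩
    refine ⟨t, fun h' => h ?_⟩
    simp [IMDP.interleave, h']
  · rintro ⟨t, h⟩
    exact ⟨(t, u), by simpa [IMDP.interleave] using h⟩

theorem IMDP.inr_mem_enabled_interleave {s : S} {u : T} {a : Act'} :
    Sum.inr a ∈ (M.interleave N).enabled (s, u) ↔ a ∈ N.enabled u := by
  constructor
  · rintro ⟨⟨t, v⟩, h⟩
    refine ⟨v, fun h' => h ?_⟩
    simp [IMDP.interleave, h']
  · rintro ⟨v, h⟩
    exact ⟨(s, v), by simpa [IMDP.interleave] using h⟩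

variable [Fintype S] [Fintype T]

theorem IMDP.mem_unc_interleave_inl {s : S} {u : T} {a : Act} {δ : S × T → ℝ} :
    δ ∈ (M.interleave N).unc (s, u) (Sum.inl a) ↔
      ∃ f ∈ M.unc s a, δ = distProd f (Pi.single u 1) := by
  constructor
  · rintro ⟨hδ, hI⟩
    have h : δ = distProd (fun x => δ (x, u)) (Pi.single u 1) := by
      ext ⟨x, v⟩
      by_cases hv : v = u
      · simp [distProd, hv]
      · have := hI (x, v)
        simp only [IMDP.interleave, hv, if_false, Set.Icc_self, Set.mem_singleton_iff] at this
        simp [distProd, hv, this]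
    refine ⟨_, ⟨⟨fun x => hδ.1 _, ?_⟩, fun x => ?_⟩, h⟩
    · rw [← hδ.2, h]
      simp [distProd, Fintype.sum_prod_type, ← Finset.mul_sum]
    · simpa [IMDP.interleave] using hI (x, u)
  · rintro ⟨f, hf, rfl⟩
    refine ⟨isDist_distProd hf.1 (isDist_single u), fun ⟨x, v⟩ => ?_⟩
    by_cases hv : v = u
    · simpa [IMDP.interleave, distProd, hv] using hf.2 x
    · simp [IMDP.interleave, distProd, hv]

theorem IMDP.mem_unc_interleave_inr {s : S} {u : T} {a : Act'} {δ : S × T → ℝ} :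
    δ ∈ (M.interleave N).unc (s, u) (Sum.inr a) ↔
      ∃ g ∈ N.unc u a, δ = distProd (Pi.single s 1) g := by
  constructor
  · rintro ⟨hδ, hI⟩
    have h : δ = distProd (Pi.single s 1) (fun v => δ (s, v)) := by
      ext ⟨x, v⟩
      by_cases hx : x = s
      · simp [distProd, hx]
      · have := hI (x, v)
        simp only [IMDP.interleave, hx, if_false, Set.Icc_self, Set.mem_singleton_iff] at this
        simp [distProd, hx, this]
    refine ⟨_, ⟨⟨fun x => hδ.1 _, ?_⟩, fun v => ?_⟩, h⟩
    · rw [← hδ.2, h]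
      simp [distProd, Fintype.sum_prod_type, ← Finset.mul_sum, ← Finset.sum_mul]
    · simpa [IMDP.interleave] using hI (s, v)
  · rintro ⟨g, hg, rfl⟩
    refine ⟨isDist_distProd (isDist_single s) hg.1, fun ⟨x, v⟩ => ?_⟩
    by_cases hx : x = s
    · simpa [IMDP.interleave, distProd, hx] using hg.2 v
    · simp [IMDP.interleave, distProd, hx]

theorem IMDP.mem_steps_interleave {s : S} {u : T} {δ : S × T → ℝ} :
    δ ∈ (M.interleave N).steps (s, u) ↔
      (∃ f ∈ M.steps s, δ = distProd f (Pi.single u 1)) ∨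
        ∃ g ∈ N.steps u, δ = distProd (Pi.single s 1) g := by
  simp only [IMDP.mem_steps, Sum.exists, IMDP.inl_mem_enabled_interleave,
    IMDP.inr_mem_enabled_interleave, IMDP.mem_unc_interleave_inl, IMDP.mem_unc_interleave_inr]
  grind

theorem IMDP.trans_interleave_of_trans_left {s : S} {f : S → ℝ} (hf : M.trans s f) (u : T) :
    (M.interleave N).trans (s, u) (distProd f (Pi.single u 1)) := by
  let φ : (S → ℝ) →ₗ[ℝ] (S × T → ℝ) :=
    { toFun := fun f => distProd f (Pi.single u 1)
      map_add' := fun f g => by ext p; simp [distProd, add_mul]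
      map_smul' := fun c f => by ext p; simp [distProd, mul_assoc] }
  have h : convexHull ℝ (M.steps s) ⊆
      φ ⁻¹' convexHull ℝ ((M.interleave N).steps (s, u)) :=
    convexHull_min
      (fun g hg => subset_convexHull ℝ _ (IMDP.mem_steps_interleave.2 (Or.inl ⟨g, hg, rfl⟩)))
      ((convex_convexHull ℝ _).linear_preimage φ)
  exact h hf

/-- A bisimulation on the left component extends to the interleaved composition. -/
theorem IMDP.IsBisim.interleave {R : S → S → Prop} (hR : M.IsBisim R) (N : IMDP T Act' AP) :
    (M.interleave N).IsBisim (prodIdRel R) := by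
  refine ⟨equivalence_prodIdRel hR.1, ?_⟩
  rintro ⟨s, u⟩ ⟨t, _⟩ ⟨hst, rfl⟩
  dsimp only at hst
  refine ⟨congrArg (· ∪ N.label u) (hR.2 s t hst).1, fun δ hδ => ?_⟩
  refine convexHull_min (fun δ hδ => ?_)
    (convex_setOf_exists_lift (prodIdRel R)
      (convex_convexHull ℝ ((M.interleave N).steps (t, u)))) hδ
  rcases IMDP.mem_steps_interleave.1 hδ with ⟨f, hf, rfl⟩ | ⟨g, hg, rfl⟩
  · obtain ⟨η, hη, hL⟩ := (hR.2 s t hst).2 f (subset_convexHull ℝ _ hf)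
    refine ⟨_, IMDP.trans_interleave_of_trans_left hη u, fun p => ?_⟩
    rw [classSum_distProd, classSum_distProd, hL]
  · refine ⟨_, subset_convexHull ℝ _ (IMDP.mem_steps_interleave.2 (Or.inr ⟨g, hg, rfl⟩)),
      fun p => ?_⟩
    have h : R p.1 s ↔ R p.1 t :=
      ⟨fun h => hR.1.trans h hst, fun h => hR.1.trans h (hR.1.symm hst)⟩
    rw [classSum_distProd, classSum_distProd, classSum_single, classSum_single, if_congr h rfl rfl]

end interleave

section transfer

variable {S T Act Act' AP : Type*} {M : IMDP S Act AP} {N : IMDP T Act' AP}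

/-- Action `a` of `M` at `s` has the same intervals as action `b` of `N` at `e s`. -/
def IMDP.SameIntervals (M : IMDP S Act AP) (N : IMDP T Act' AP) (e : S ≃ T) (s : S)
    (a : Act) (b : Act') : Prop :=
  ∀ t, M.low s a t = N.low (e s) b (e t) ∧ M.high s a t = N.high (e s) b (e t)

variable {e : S ≃ T} {s : S} {a : Act} {b : Act'}

theorem IMDP.SameIntervals.mem_enabled_iff (h : M.SameIntervals N e s a b) :
    a ∈ M.enabled s ↔ b ∈ N.enabled (e s) := by
  simp only [IMDP.enabled, Set.mem_ofPred_eq, (h _).1, (h _).2]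
  exact e.exists_congr_right (q := fun t => ¬(N.low (e s) b t = 0 ∧ N.high (e s) b t = 0))

variable [Fintype S] [Fintype T]

theorem IMDP.SameIntervals.comp_mem_unc_iff (h : M.SameIntervals N e s a b) {δ : T → ℝ} :
    δ ∘ e ∈ M.unc s a ↔ δ ∈ N.unc (e s) b := by
  simp only [IMDP.unc, IsDist, Set.mem_ofPred_eq, Function.comp_apply, (h _).1, (h _).2,
    e.sum_comp δ, e.forall_congr_right (q := fun t => 0 ≤ δ t),
    e.forall_congr_right (q := fun t => δ t ∈ Set.Icc (N.low (e s) b t) (N.high (e s) b t))]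

theorem IMDP.trans_iff_of_sameIntervals
    (hM : ∀ a ∈ M.enabled s, ∃ b, M.SameIntervals N e s a b)
    (hN : ∀ b ∈ N.enabled (e s), ∃ a, M.SameIntervals N e s a b) {δ : S → ℝ} :
    M.trans s δ ↔ ∃ η, N.trans (e s) η ∧ η ∘ e = δ := by
  have h : M.steps s = LinearMap.funLeft ℝ ℝ e '' N.steps (e s) := by
    ext δ
    constructor
    · intro hδ
      obtain ⟨a, ha, hδ⟩ := IMDP.mem_steps.1 hδ
      obtain ⟨b, hab⟩ := hM a ha
      have hc : (δ ∘ e.symm) ∘ e = δ := by ext; simp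
      refine ⟨δ ∘ e.symm, IMDP.mem_steps.2 ⟨b, hab.mem_enabled_iff.1 ha, ?_⟩, hc⟩
      rwa [← hab.comp_mem_unc_iff, hc]
    · rintro ⟨δ, hδ, rfl⟩
      obtain ⟨b, hb, hδ⟩ := IMDP.mem_steps.1 hδ
      obtain ⟨a, hab⟩ := hN b hb
      exact IMDP.mem_steps.2 ⟨a, hab.mem_enabled_iff.2 hb, hab.comp_mem_unc_iff.2 hδ⟩
  change δ ∈ convexHull ℝ (M.steps s) ↔ _
  rw [h, ← LinearMap.image_convexHull]
  rfl

theorem classSum_comp_equiv (e : S ≃ T) (R : T → T → Prop) (δ : T → ℝ) (x : S) :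
    classSum (fun x y => R (e x) (e y)) (δ ∘ e) x = classSum R δ (e x) :=
  e.sum_comp fun y => if R (e x) y then δ y else 0

/-- Bisimulations pull back along a bijection of states that preserves labels and intervals. -/
theorem IMDP.IsBisim.comap {R : T → T → Prop} (hR : N.IsBisim R) (e : S ≃ T)
    (hlabel : ∀ s, M.label s = N.label (e s))
    (hM : ∀ s, ∀ a ∈ M.enabled s, ∃ b, M.SameIntervals N e s a b)
    (hN : ∀ s, ∀ b ∈ N.enabled (e s), ∃ a, M.SameIntervals N e s a b) :
    M.IsBisim fun x y => R (e x) (e y) := by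
  refine ⟨hR.1.comap e, fun s t hst => ?_⟩
  obtain ⟨hl, hstep⟩ := hR.2 _ _ hst
  refine ⟨by rw [hlabel, hlabel, hl], fun δ hδ => ?_⟩
  obtain ⟨δ', hδ', rfl⟩ := (IMDP.trans_iff_of_sameIntervals (hM s) (hN s)).1 hδ
  obtain ⟨η, hη, hL⟩ := hstep δ' hδ'
  refine ⟨η ∘ e, (IMDP.trans_iff_of_sameIntervals (hM t) (hN t)).2 ⟨η, hη, rfl⟩, fun x => ?_⟩
  rw [classSum_comp_equiv, classSum_comp_equiv, hL]

end transfer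

section distrib

variable {S₁ S₂ S₃ Act₁ Act₂ Act₃ AP : Type*}
  (M₁ : IMDP S₁ Act₁ AP) (M₂ : IMDP S₂ Act₂ AP) (M₃ : IMDP S₃ Act₃ AP)

theorem IMDP.sameIntervals_distrib_inl_inl (s : S₁) (u : S₃) (a : Act₁) :
    ((M₁.interleave M₃).disjUnion (M₂.interleave M₃)).SameIntervals
      ((M₁.disjUnion M₂).interleave M₃) (Equiv.sumProdDistrib S₁ S₂ S₃).symm
      (Sum.inl (s, u)) (Sum.inl (Sum.inl a)) (Sum.inl (Sum.inl a)) := by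
  rintro (⟨t, v⟩ | ⟨t, v⟩)
  · exact ⟨rfl, rfl⟩
  · exact ⟨(ite_self _).symm, (ite_self _).symm⟩

theorem IMDP.sameIntervals_distrib_inl_inr (s : S₁) (u : S₃) (a : Act₃) :
    ((M₁.interleave M₃).disjUnion (M₂.interleave M₃)).SameIntervals
      ((M₁.disjUnion M₂).interleave M₃) (Equiv.sumProdDistrib S₁ S₂ S₃).symm
      (Sum.inl (s, u)) (Sum.inl (Sum.inr a)) (Sum.inr a) := by
  rintro (⟨t, v⟩ | ⟨t, v⟩)
  · exact ⟨@if_congr _ _ _ _ (_) _ _ _ _ Sum.inl_injective.eq_iff.symm rfl rfl,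
      @if_congr _ _ _ _ (_) _ _ _ _ Sum.inl_injective.eq_iff.symm rfl rfl⟩
  · exact ⟨(if_neg Sum.inr_ne_inl).symm, (if_neg Sum.inr_ne_inl).symm⟩

theorem IMDP.sameIntervals_distrib_inr_inl (s : S₂) (u : S₃) (a : Act₂) :
    ((M₁.interleave M₃).disjUnion (M₂.interleave M₃)).SameIntervals
      ((M₁.disjUnion M₂).interleave M₃) (Equiv.sumProdDistrib S₁ S₂ S₃).symm
      (Sum.inr (s, u)) (Sum.inr (Sum.inl a)) (Sum.inl (Sum.inr a)) := by
  rintro (⟨t, v⟩ | ⟨t, v⟩)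
  · exact ⟨(ite_self _).symm, (ite_self _).symm⟩
  · exact ⟨rfl, rfl⟩

theorem IMDP.sameIntervals_distrib_inr_inr (s : S₂) (u : S₃) (a : Act₃) :
    ((M₁.interleave M₃).disjUnion (M₂.interleave M₃)).SameIntervals
      ((M₁.disjUnion M₂).interleave M₃) (Equiv.sumProdDistrib S₁ S₂ S₃).symm
      (Sum.inr (s, u)) (Sum.inr (Sum.inr a)) (Sum.inr a) := by
  rintro (⟨t, v⟩ | ⟨t, v⟩)
  · exact ⟨(if_neg Sum.inl_ne_inr).symm, (if_neg Sum.inl_ne_inr).symm⟩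
  · exact ⟨@if_congr _ _ _ _ (_) _ _ _ _ Sum.inr_injective.eq_iff.symm rfl rfl,
      @if_congr _ _ _ _ (_) _ _ _ _ Sum.inr_injective.eq_iff.symm rfl rfl⟩

theorem IMDP.inr_notMem_enabled_disjUnion_inl (s : S₁) (a : Act₂) :
    Sum.inr a ∉ (M₁.disjUnion M₂).enabled (Sum.inl s) := by
  rintro ⟨t | t, h⟩ <;> exact h ⟨rfl, rfl⟩

theorem IMDP.inl_notMem_enabled_disjUnion_inr (s : S₂) (a : Act₁) :
    Sum.inl a ∉ (M₁.disjUnion M₂).enabled (Sum.inr s) := by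
  rintro ⟨t | t, h⟩ <;> exact h ⟨rfl, rfl⟩

end distrib

/-- `∼c` is a congruence with respect to the interleaved composition of
IMDPs: if `M₁ ∼c M₂` then `M₁ ||| M₃ ∼c M₂ ||| M₃`. -/
theorem imdp_bisimilar_interleave {S₁ S₂ S₃ Act₁ Act₂ Act₃ AP : Type*}
    [Fintype S₁] [Fintype S₂] [Fintype S₃] [Fintype Act₁] [Fintype Act₂] [Fintype Act₃]
    (M₁ : IMDP S₁ Act₁ AP) (M₂ : IMDP S₂ Act₂ AP) (M₃ : IMDP S₃ Act₃ AP)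
    (h₁ : M₁.WF) (h₂ : M₂.WF) (h₃ : M₃.WF)
    (h : M₁.Bisimilar M₂) :
    (M₁.interleave M₃).Bisimilar (M₂.interleave M₃) := by
  obtain ⟨R, hR, hstart⟩ := h
  refine ⟨_, (hR.interleave M₃).comap (Equiv.sumProdDistrib S₁ S₂ S₃).symm ?_ ?_ ?_,
    hstart, rfl⟩
  · rintro (⟨s, u⟩ | ⟨s, u⟩) <;> rfl
  · rintro (⟨s, u⟩ | ⟨s, u⟩) (a | a) ha
    · rcases a with a | a
      · exact ⟨_, IMDP.sameIntervals_distrib_inl_inl M₁ M₂ M₃ s u a⟩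
      · exact ⟨_, IMDP.sameIntervals_distrib_inl_inr M₁ M₂ M₃ s u a⟩
    · exact absurd ha (IMDP.inr_notMem_enabled_disjUnion_inl _ _ _ _)
    · exact absurd ha (IMDP.inl_notMem_enabled_disjUnion_inr _ _ _ _)
    · rcases a with a | a
      · exact ⟨_, IMDP.sameIntervals_distrib_inr_inl M₁ M₂ M₃ s u a⟩
      · exact ⟨_, IMDP.sameIntervals_distrib_inr_inr M₁ M₂ M₃ s u a⟩
  · rintro (⟨s, u⟩ | ⟨s, u⟩) ((a | a) | a) ha
    · exact ⟨_, IMDP.sameIntervals_distrib_inl_inl M₁ M₂ M₃ s u a⟩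
    · exact absurd (IMDP.inl_mem_enabled_interleave.1 ha)
        (IMDP.inr_notMem_enabled_disjUnion_inl _ _ _ _)
    · exact ⟨_, IMDP.sameIntervals_distrib_inl_inr M₁ M₂ M₃ s u a⟩
    · exact absurd (IMDP.inl_mem_enabled_interleave.1 ha)
        (IMDP.inl_notMem_enabled_disjUnion_inr _ _ _ _)
    · exact ⟨_, IMDP.sameIntervals_distrib_inr_inl M₁ M₂ M₃ s u a⟩
    · exact ⟨_, IMDP.sameIntervals_distrib_inr_inr M₁ M₂ M₃ s u a⟩
end

section
/- The unfolding of the folding is not the identity in general: there exists a finite-state finite-transition probabilistic automaton A such that UF(F(A)) ≠ A, i.e., the transition relation of UF(F(A)) differs from that of A. -/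
open scoped Classical

/-- The value of a discrete probability distribution lies in the unit interval. -/
theorem IsDist.mem_Icc {S : Type*} [Fintype S] {δ : S → ℝ} (h : IsDist δ) (t : S) :
    δ t ∈ Set.Icc (0 : ℝ) 1 :=
  ⟨h.1 t, h.2 ▸ Finset.single_le_sum (fun s _ => h.1 s) (Finset.mem_univ t)⟩

/-- Every transition target of a well-formed PA is feasible in its folding. -/
theorem PA.WF.mem_unc_fold {S AP : Type*} [Fintype S] {A : PA S AP} (hA : A.WF)
    {s : S} {δ : S → ℝ} (h : (s, δ) ∈ A.trans) : δ ∈ A.fold.unc s () := by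
  refine ⟨hA.2 _ h, fun t => ?_⟩
  have hsub : (fun δ : S → ℝ => δ t) '' convexHull ℝ {η | (s, η) ∈ A.trans} ⊆
      Set.Icc (0 : ℝ) 1 := by
    rw [Set.image_subset_iff]
    exact convexHull_min (fun η hη => (hA.2 _ hη).mem_Icc t)
      ((convex_Icc (0 : ℝ) 1).linear_preimage (LinearMap.proj t : (S → ℝ) →ₗ[ℝ] ℝ))
  have hmem : δ t ∈ (fun δ : S → ℝ => δ t) '' convexHull ℝ {η | (s, η) ∈ A.trans} :=
    Set.mem_image_of_mem _ (subset_convexHull ℝ _ h)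
  exact ⟨csInf_le (bddBelow_Icc.mono hsub) hmem, le_csSup (bddAbove_Icc.mono hsub) hmem⟩

/-- A transition target lying strictly between two distinct other targets of the same state
is lost by folding and unfolding. -/
theorem PA.WF.notMem_unfold_fold {S AP : Type*} [Fintype S] {A : PA S AP} (hA : A.WF)
    {s : S} {δ δ₁ δ₂ : S → ℝ} (h₁ : (s, δ₁) ∈ A.trans) (h₂ : (s, δ₂) ∈ A.trans)
    (hδ : δ ∈ openSegment ℝ δ₁ δ₂) (hne : δ₁ ≠ δ) : (s, δ) ∉ A.fold.unfold.trans := by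
  rintro ⟨_, _, hext⟩
  exact hne (hext.2 (hA.mem_unc_fold h₁) (hA.mem_unc_fold h₂) hδ)

/-- the unfolding of the folding is not the identity in general: there is a
finite-state finite-transition PA `A` whose transition relation differs from that of
`UF(F(A))`. -/
theorem unfold_fold_ne : ∃ (S AP : Type) (inst : Fintype S) (A : PA S AP),
    @PA.WF S AP inst A ∧
      (@IMDP.unfold S Unit AP inst (@PA.fold S AP inst A)).trans ≠ A.trans := by
  let δ₁ : Bool → ℝ := fun b => if b then 1 else 0
  let δ₂ : Bool → ℝ := fun b => if b then 0 else 1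
  let δ : Bool → ℝ := fun _ => 1 / 2
  let A : PA Bool Unit := ⟨true, fun _ => ∅, {(true, δ₁), (true, δ₂), (true, δ)}⟩
  have hA : A.WF := by
    refine ⟨by simp [A], ?_⟩
    rintro p (rfl | rfl | rfl)
    all_goals norm_num [IsDist, δ₁, δ₂, δ]
  refine ⟨Bool, Unit, inferInstance, A, hA, fun h => ?_⟩
  refine hA.notMem_unfold_fold (s := true) (δ := δ) (δ₁ := δ₁) (δ₂ := δ₂)
    (by simp [A]) (by simp [A]) ?_ ?_ (h ▸ by simp [A])
  · refine ⟨1 / 2, 1 / 2, by norm_num, by norm_num, by norm_num, ?_⟩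
    ext b
    cases b <;> simp [δ, δ₁, δ₂]
  · intro he
    have := congrFun he true
    norm_num [δ, δ₁] at this
end

section
/- The folding of the unfolding is not the identity in general: there exists a finite-state finite-transition interval Markov decision process M such that F(UF(M)) ≠ M. -/
open scoped Classical

/-- The IMDP with a single state whose self-loop carries the interval `[0, 1]`. -/
def unitLoop : IMDP Unit Unit Unit where
  start := ()
  label := fun _ => ∅
  low := fun _ _ _ => 0
  high := fun _ _ _ => 1

theorem unitLoop_enabled (s : Unit) : unitLoop.enabled s = Set.univ := by
  ext a
  simp [IMDP.enabled, unitLoop]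

theorem unitLoop_unc (s a : Unit) : unitLoop.unc s a = {fun _ => (1 : ℝ)} := by
  ext δ
  simp only [IMDP.unc, IsDist, unitLoop, Set.mem_ofPred_eq, Set.mem_singleton_iff, funext_iff,
    Set.mem_Icc, Unique.forall_iff, Fintype.sum_unique]
  constructor
  · rintro ⟨⟨-, h⟩, -⟩
    exact h
  · intro h
    simp [h]

theorem unitLoop_wf : unitLoop.WF := by
  refine ⟨fun s a s' => by simp [unitLoop], fun s => ?_, fun s a _ => ?_⟩
  · rw [unitLoop_enabled]
    exact Set.univ_nonempty
  · rw [unitLoop_unc]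
    exact Set.singleton_nonempty _

theorem unitLoop_fold_unfold_low : unitLoop.unfold.fold.low () () () = 1 := by
  have h : {η | ((), η) ∈ unitLoop.unfold.trans} = {fun _ => (1 : ℝ)} := by
    ext η
    simp [IMDP.unfold, unitLoop_enabled, unitLoop_unc]
  simp [PA.fold, h]

/-- the folding of the unfolding is not the identity in general: there is a
finite-state IMDP `M` with `F(UF(M)) ≠ M`. -/
theorem fold_unfold_ne : ∃ (S AP : Type) (inst : Fintype S) (M : IMDP S Unit AP),
    @IMDP.WF S Unit AP inst M ∧
      @PA.fold S AP inst (@IMDP.unfold S Unit AP inst M) ≠ M := by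
  refine ⟨Unit, Unit, inferInstance, unitLoop, unitLoop_wf, fun h => ?_⟩
  have hlow := unitLoop_fold_unfold_low
  rw [h] at hlow
  exact zero_ne_one hlow
end

section
/- Lifting is preserved by taking products with a fixed distribution modulo the identity relation: let X and Y be finite sets, R an equivalence relation on X, δ₁, δ₂ discrete probability distributions on X with δ₁ L(R) δ₂, and δ₃ a discrete probability distribution on Y. Then δ₁ × δ₃ L(R × id_Y) δ₂ × δ₃, where R × id_Y is the equivalence relation on X × Y relating (x,u) and (y,v) iff (x,y) ∈ R and u = v. -/
open scoped Classical

/-- The `R × id_Y`-class of `(x, u)` has product probability `δ([x]_R) * δ' u`. -/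
theorem classSum_prodIdRel_distProd {X Y : Type*} [Fintype X] [Fintype Y]
    (R : X → X → Prop) (δ : X → ℝ) (δ' : Y → ℝ) (p : X × Y) :
    classSum (prodIdRel R) (distProd δ δ') p = classSum R δ p.1 * δ' p.2 := by
  simp only [classSum, prodIdRel, distProd, Fintype.sum_prod_type, Finset.sum_mul, ite_mul, zero_mul]
  refine Finset.sum_congr rfl fun x _ => ?_
  by_cases h : R p.1 x <;> simp [h]

/-- lifting is preserved by products with a fixed distribution modulo the
identity relation: if `δ₁ L(R) δ₂` then `δ₁ × δ₃ L(R × id_Y) δ₂ × δ₃`. -/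
theorem lift_distProd {X Y : Type*} [Fintype X] [Fintype Y]
    (R : X → X → Prop) (hR : Equivalence R)
    (δ₁ δ₂ : X → ℝ) (h₁ : IsDist δ₁) (h₂ : IsDist δ₂) (hL : Lift R δ₁ δ₂)
    (δ₃ : Y → ℝ) (h₃ : IsDist δ₃) :
    Lift (prodIdRel R) (distProd δ₁ δ₃) (distProd δ₂ δ₃) := by
  intro p
  rw [classSum_prodIdRel_distProd, classSum_prodIdRel_distProd, hL]
end
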